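/- Fix v ∈ (0,1) and a real exponent q with 1 < q < ∞. Define, for u ∈ L^q(0,∞), the operator (Ru)(x) = (sin(vπ)/π) ∫₀^∞ x·u(y)/(x² + y² + 2xy·cos(vπ)) dy. Then for almost every x > 0 the defining integral converges absolutely, Ru ∈ L^q(0,∞), and ‖Ru‖_{L^q} ≤ (sin(vπ/q)/sin(π/q))·‖u‖_{L^q}. -/

import Mathlib

open MeasureTheory Real


lemma aux_lint_gamma {s r : ℝ} (hs : 0 < s) (hr : 0 < r) :
    ∫⁻ t in Set.Ioi (0:ℝ), ENNReal.ofReal (t ^ (s - 1) * Real.exp (-(r * t)))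
      = ENNReal.ofReal ((1 / r) ^ s * Real.Gamma s) := by
  have h := Real.integral_rpow_mul_exp_neg_mul_Ioi hs hr
  have hpos : 0 < (1 / r) ^ s * Real.Gamma s :=
    mul_pos (rpow_pos_of_pos (by positivity) _) (Real.Gamma_pos_of_pos hs)
  have hint : Integrable (fun t : ℝ => t ^ (s - 1) * Real.exp (-(r * t)))
      (volume.restrict (Set.Ioi (0:ℝ))) := by
    by_contra hn
    rw [integral_undef hn] at h
    linarith
  rw [← h, ofReal_integral_eq_lintegral_ofReal hint]
  filter_upwards [ae_restrict_mem measurableSet_Ioi] with t ht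
  have : (0:ℝ) < t := ht
  positivity

lemma aux_lint_one {a : ℝ} (ha : 0 < a) (ha1 : a < 1) :
    ∫⁻ t in Set.Ioi (0:ℝ), ENNReal.ofReal (t ^ (-a) / (1 + t))
      = ENNReal.ofReal (π / Real.sin (π * a)) := by
  have h1 : ∀ t ∈ Set.Ioi (0:ℝ), ENNReal.ofReal (t ^ (-a) / (1 + t))
      = ∫⁻ x in Set.Ioi (0:ℝ), ENNReal.ofReal (t ^ (-a) * Real.exp (-((1 + t) * x))) := by
    intro t ht
    have ht : (0:ℝ) < t := ht
    have := aux_lint_gamma (s := 1) (r := 1 + t) one_pos (by positivity)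
    simp only [sub_self, rpow_zero, one_mul, Real.Gamma_one, rpow_one, mul_one] at this
    rw [div_eq_mul_one_div, ENNReal.ofReal_mul (by positivity), ← this, ← lintegral_const_mul]
    · refine lintegral_congr fun x => ?_
      rw [ENNReal.ofReal_mul (by positivity)]
    · fun_prop
  rw [setLIntegral_congr_fun measurableSet_Ioi h1, lintegral_lintegral_swap]
  swap
  · apply Measurable.aemeasurable
    unfold Function.uncurry
    fun_prop
  have h2 : ∀ x ∈ Set.Ioi (0:ℝ),
      ∫⁻ t in Set.Ioi (0:ℝ), ENNReal.ofReal (t ^ (-a) * Real.exp (-((1 + t) * x)))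
      = ENNReal.ofReal (Real.Gamma (1 - a)) *
        ENNReal.ofReal (x ^ (a - 1) * Real.exp (-(1 * x))) := by
    intro x hx
    have hx : (0:ℝ) < x := hx
    have hG : 0 < Real.Gamma (1 - a) := Real.Gamma_pos_of_pos (by linarith)
    have := aux_lint_gamma (s := 1 - a) (r := x) (by linarith) hx
    rw [← ENNReal.ofReal_mul hG.le]
    have e : Real.Gamma (1 - a) * (x ^ (a - 1) * Real.exp (-(1 * x)))
       = Real.exp (-x) * ((1 / x) ^ (1 - a) * Real.Gamma (1 - a)) := by
      rw [one_div, inv_rpow hx.le, ← rpow_neg hx.le, neg_sub]; ring_nf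
    rw [e, ENNReal.ofReal_mul (by positivity), ← this, ← lintegral_const_mul]
    · refine lintegral_congr fun t => ?_
      rw [← ENNReal.ofReal_mul (by positivity)]
      congr 1
      rw [show -((1 + t) * x) = -x + -(x * t) by ring, Real.exp_add,
        show 1 - a - 1 = -a by ring]
      ring
    · fun_prop
  rw [setLIntegral_congr_fun measurableSet_Ioi h2, lintegral_const_mul _ (by fun_prop),
    aux_lint_gamma ha one_pos, ← ENNReal.ofReal_mul (Real.Gamma_pos_of_pos (by linarith)).le,
    ← Real.Gamma_mul_Gamma_one_sub]
  congr 1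
  simp [mul_comm]

lemma aux_int_one {a : ℝ} (ha : 0 < a) (ha1 : a < 1) :
    IntegrableOn (fun t : ℝ => t ^ (-a) / (1 + t)) (Set.Ioi 0) ∧
    ∫ t in Set.Ioi (0:ℝ), t ^ (-a) / (1 + t) = π / Real.sin (π * a) := by
  have h := aux_lint_one ha ha1
  have hnn : 0 ≤ᵐ[volume.restrict (Set.Ioi (0:ℝ))] (fun t : ℝ => t ^ (-a) / (1 + t)) := by
    filter_upwards [ae_restrict_mem measurableSet_Ioi] with t ht
    have : (0:ℝ) < t := ht
    simp only [Pi.zero_apply]; positivity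
  have hm : AEStronglyMeasurable (fun t : ℝ => t ^ (-a) / (1 + t))
    (volume.restrict (Set.Ioi (0:ℝ))) := by
    apply Measurable.aestronglyMeasurable
    fun_prop
  have hs : 0 < Real.sin (π * a) := Real.sin_pos_of_pos_of_lt_pi (by positivity)
    (by nlinarith [pi_pos])
  constructor
  · refine ⟨hm, ?_⟩
    rw [hasFiniteIntegral_iff_ofReal hnn, h]
    exact ENNReal.ofReal_lt_top
  · rw [integral_eq_lintegral_of_nonneg_ae hnn hm, h, ENNReal.toReal_ofReal (by positivity)]

lemma aux_lower {z₀ : ℂ} (hz : z₀ ∈ Complex.slitPlane) :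
    ∃ c : ℝ, 0 < c ∧ ∀ᶠ z in nhds z₀, ∀ t : ℝ, 0 < t → c * (1 + t) ^ 2 ≤ ‖(t:ℂ) + z‖ ^ 2 := by
  have hz0 : z₀ ≠ 0 := Complex.slitPlane_ne_zero hz
  have hn : 0 < ‖z₀‖ := norm_pos_iff.2 hz0
  have hm : 0 < (‖z₀‖ + z₀.re) / (2 * ‖z₀‖) := by
    apply div_pos _ (by positivity)
    rcases hz with h | h
    · linarith
    · have := Complex.abs_re_lt_norm.2 h
      linarith [neg_abs_le z₀.re]
  set m := (‖z₀‖ + z₀.re) / (2 * ‖z₀‖) with hmdef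
  have hρ : 0 < min (‖z₀‖ / 2) 1 := by positivity
  set ρ := min (‖z₀‖ / 2) 1 with hρd
  refine ⟨m / 2 * ρ ^ 2, by positivity, ?_⟩
  have e1 : ∀ᶠ z in nhds z₀, m / 2 < (‖z‖ + z.re) / (2 * ‖z‖) := by
    have hc : ContinuousAt (fun z : ℂ => (‖z‖ + z.re) / (2 * ‖z‖)) z₀ := by
      apply ContinuousAt.div
      · exact (continuous_norm.add Complex.continuous_re).continuousAt
      · fun_prop
      · positivity
    exact hc.eventually (lt_mem_nhds (by simp only; rw [← hmdef]; linarith))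
  have e2 : ∀ᶠ z in nhds z₀, ‖z₀‖ / 2 < ‖z‖ :=
    continuous_norm.continuousAt.eventually (lt_mem_nhds (by linarith))
  filter_upwards [e1, e2] with z h1 h2 t ht
  have hzp : 0 < ‖z‖ := by linarith
  have hsq : ‖(t:ℂ) + z‖ ^ 2 = t ^ 2 + 2 * t * z.re + ‖z‖ ^ 2 := by
    rw [Complex.sq_norm, Complex.sq_norm, Complex.normSq_apply, Complex.normSq_apply]
    simp
    ring
  have hre : z.re ≤ ‖z‖ := Complex.re_le_norm z
  have key : (t + ‖z‖) ^ 2 * ((‖z‖ + z.re) / (2 * ‖z‖)) ≤ ‖(t:ℂ) + z‖ ^ 2 := by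
    rw [hsq, ← mul_div_assoc, div_le_iff₀ (by positivity)]
    nlinarith [mul_nonneg (sq_nonneg (t - ‖z‖)) (sub_nonneg.2 hre)]
  have hρ1 : ρ ≤ 1 := min_le_right _ _
  have hρ2 : ρ ≤ ‖z‖ := (min_le_left _ _).trans h2.le
  have h3 : ρ * (1 + t) ≤ t + ‖z‖ := by nlinarith
  calc m / 2 * ρ ^ 2 * (1 + t) ^ 2 = (ρ * (1 + t)) ^ 2 * (m / 2) := by ring
    _ ≤ (t + ‖z‖) ^ 2 * ((‖z‖ + z.re) / (2 * ‖z‖)) := by gcongr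
    _ ≤ _ := key

lemma aux_integrable {a : ℝ} (ha : 0 < a) (ha1 : a < 1) {z : ℂ} (hz : z ∈ Complex.slitPlane) :
    IntegrableOn (fun t : ℝ => ((t ^ (-a) : ℝ) : ℂ) / ((t:ℂ) + z)) (Set.Ioi 0) := by
  obtain ⟨c, hc, h⟩ := aux_lower hz
  have h := h.self_of_nhds
  have hi := ((aux_int_one ha ha1).1).const_mul (√c)⁻¹
  refine Integrable.mono' hi ?_ ?_
  · apply Measurable.aestronglyMeasurable
    fun_prop
  filter_upwards [ae_restrict_mem measurableSet_Ioi] with t ht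
  have ht : (0:ℝ) < t := ht
  have h' := h t ht
  have hn : √c * (1 + t) ≤ ‖(t:ℂ) + z‖ := by
    refine (sq_le_sq₀ (by positivity) (norm_nonneg _)).1 ?_
    rwa [mul_pow, Real.sq_sqrt hc.le]
  have hsc : 0 < √c := Real.sqrt_pos.2 hc
  rw [norm_div, Complex.norm_real, Real.norm_of_nonneg (by positivity)]
  calc t ^ (-a) / ‖(t:ℂ) + z‖ ≤ t ^ (-a) / (√c * (1 + t)) := by gcongr
    _ = _ := by field_simp

lemma aux_diff {a : ℝ} (ha : 0 < a) (ha1 : a < 1) {z : ℂ} (hz : z ∈ Complex.slitPlane) :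
    DifferentiableAt ℂ (fun z : ℂ => ∫ t in Set.Ioi (0:ℝ), ((t ^ (-a) : ℝ) : ℂ) / ((t:ℂ) + z)) z := by
  obtain ⟨c, hc, h⟩ := aux_lower hz
  have hi := ((aux_int_one ha ha1).1).const_mul c⁻¹
  have := (hasDerivAt_integral_of_dominated_loc_of_deriv_le
    (μ := volume.restrict (Set.Ioi (0:ℝ)))
    (F := fun (z : ℂ) (t : ℝ) => ((t ^ (-a) : ℝ) : ℂ) / ((t:ℂ) + z))
    (F' := fun (z : ℂ) (t : ℝ) => - ((t ^ (-a) : ℝ) : ℂ) / ((t:ℂ) + z) ^ 2)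
    (bound := fun t => c⁻¹ * (t ^ (-a) / (1 + t))) (x₀ := z) h ?_ (aux_integrable ha ha1 hz)
    ?_ ?_ hi ?_).2
  · exact this.differentiableAt
  · refine Filter.Eventually.of_forall fun z => ?_
    apply Measurable.aestronglyMeasurable
    fun_prop
  · apply Measurable.aestronglyMeasurable
    fun_prop
  · filter_upwards [ae_restrict_mem measurableSet_Ioi] with t ht w hw
    have ht : (0:ℝ) < t := ht
    have h' : c * (1 + t) ^ 2 ≤ ‖(t:ℂ) + w‖ ^ 2 := hw t ht
    rw [norm_div, norm_neg, Complex.norm_real, Real.norm_of_nonneg (by positivity), norm_pow]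
    have h2 : c * (1 + t) ≤ c * (1 + t) ^ 2 := by
      gcongr
      nlinarith
    calc t ^ (-a) / ‖(t:ℂ) + w‖ ^ 2 ≤ t ^ (-a) / (c * (1 + t)) := by
          gcongr; exact h2.trans h'
      _ = _ := by field_simp
  · filter_upwards [ae_restrict_mem measurableSet_Ioi] with t ht w hw
    have ht : (0:ℝ) < t := ht
    have h' : c * (1 + t) ^ 2 ≤ ‖(t:ℂ) + w‖ ^ 2 := hw t ht
    have hne : (t:ℂ) + w ≠ 0 := by
      intro h0
      rw [h0] at h'
      simp only [norm_zero] at h'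
      have : 0 < c * (1 + t) ^ 2 := by positivity
      linarith
    have h1 : HasDerivAt (fun w : ℂ => (t:ℂ) + w) 1 w := (hasDerivAt_id w).const_add _
    have := (hasDerivAt_const w ((t ^ (-a) : ℝ) : ℂ)).div h1 hne
    exact this.congr_deriv (by simp)

lemma aux_real {a : ℝ} (ha : 0 < a) (ha1 : a < 1) {x : ℝ} (hx : 0 < x) :
    ∫ t in Set.Ioi (0:ℝ), ((t ^ (-a) : ℝ) : ℂ) / ((t:ℂ) + (x:ℂ))
      = ((π / Real.sin (π * a) : ℝ) : ℂ) * (x:ℂ) ^ (-a : ℂ) := by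
  have h1 : ∀ t : ℝ, ((t ^ (-a) : ℝ) : ℂ) / ((t:ℂ) + (x:ℂ)) = ((t ^ (-a) / (t + x) : ℝ) : ℂ) := by
    intro t; push_cast; rfl
  simp_rw [h1]
  rw [integral_complex_ofReal]
  have h2 := integral_comp_mul_left_Ioi (fun t : ℝ => t ^ (-a) / (t + x)) 0 hx
  rw [mul_zero] at h2
  have h3 : ∀ t ∈ Set.Ioi (0:ℝ), (x * t) ^ (-a) / (x * t + x)
      = (x ^ (-a) * x⁻¹) * (t ^ (-a) / (1 + t)) := by
    intro t ht
    have ht : (0:ℝ) < t := ht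
    rw [mul_rpow hx.le ht.le]
    field_simp
    ring
  rw [setIntegral_congr_fun measurableSet_Ioi h3, integral_const_mul, (aux_int_one ha ha1).2,
    smul_eq_mul] at h2
  have h4 : ∫ t in Set.Ioi (0:ℝ), t ^ (-a) / (t + x) = π / Real.sin (π * a) * x ^ (-a) := by
    have : x⁻¹ ≠ 0 := by positivity
    apply mul_left_cancel₀ this
    rw [← h2]; ring
  rw [h4]
  rw [Complex.ofReal_mul]
  rw [Complex.ofReal_cpow hx.le]
  push_cast
  rfl

lemma aux_stieltjes {a : ℝ} (ha : 0 < a) (ha1 : a < 1) {z : ℂ} (hz : z ∈ Complex.slitPlane) :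
    ∫ t in Set.Ioi (0:ℝ), ((t ^ (-a) : ℝ) : ℂ) / ((t:ℂ) + z)
      = ((π / Real.sin (π * a) : ℝ) : ℂ) * z ^ (-a : ℂ) := by
  have hf : AnalyticOnNhd ℂ
      (fun z : ℂ => ∫ t in Set.Ioi (0:ℝ), ((t ^ (-a) : ℝ) : ℂ) / ((t:ℂ) + z))
      Complex.slitPlane :=
    DifferentiableOn.analyticOnNhd
      (fun w hw => (aux_diff ha ha1 hw).differentiableWithinAt) Complex.isOpen_slitPlane
  have hg : AnalyticOnNhd ℂ
      (fun z : ℂ => ((π / Real.sin (π * a) : ℝ) : ℂ) * z ^ (-a : ℂ)) Complex.slitPlane := by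
    apply DifferentiableOn.analyticOnNhd _ Complex.isOpen_slitPlane
    intro w hw
    exact ((differentiableAt_id.cpow_const hw).const_mul _).differentiableWithinAt
  have hpre : IsPreconnected Complex.slitPlane :=
    (Complex.starConvex_one_slitPlane.isPathConnected Complex.one_mem_slitPlane).isConnected.isPreconnected
  refine hf.eqOn_of_preconnected_of_mem_closure hg hpre Complex.one_mem_slitPlane ?_ hz
  have ht : Filter.Tendsto (fun n : ℕ => ((1 + 1 / ((n:ℝ) + 1) : ℝ) : ℂ)) Filter.atTop
      (nhds (1:ℂ)) := by
    have h1 : Filter.Tendsto (fun n : ℕ => (1 + 1 / ((n:ℝ) + 1) : ℝ)) Filter.atTop (nhds 1) := by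
      simpa using tendsto_one_div_add_atTop_nhds_zero_nat.const_add (1:ℝ)
    exact (Complex.continuous_ofReal.tendsto 1).comp h1
  refine mem_closure_of_tendsto ht (Filter.Eventually.of_forall fun n => ⟨?_, ?_⟩)
  · exact aux_real ha ha1 (by positivity)
  · simp only [Set.mem_singleton_iff]
    intro h
    have h' : (1 + 1 / ((n:ℝ) + 1) : ℝ) = 1 := by exact_mod_cast h
    have : 0 < 1 / ((n:ℝ) + 1) := by positivity
    linarith

lemma aux_kernel {a θ : ℝ} (ha : 0 < a) (ha1 : a < 1) (hθ : 0 < θ) (hθ1 : θ < π) :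
    IntegrableOn (fun t : ℝ => t ^ (-a) / (1 + t ^ 2 + 2 * t * Real.cos θ)) (Set.Ioi 0) ∧
    ∫ t in Set.Ioi (0:ℝ), t ^ (-a) / (1 + t ^ 2 + 2 * t * Real.cos θ)
      = π / Real.sin (π * a) * (Real.sin (a * θ) / Real.sin θ) := by
  have hs : 0 < Real.sin θ := Real.sin_pos_of_pos_of_lt_pi hθ hθ1
  have hcs : Real.cos θ ^ 2 + Real.sin θ ^ 2 = 1 := Real.cos_sq_add_sin_sq θ
  set z : ℂ := ⟨Real.cos θ, -Real.sin θ⟩ with hzdef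
  have hz : z ∈ Complex.slitPlane := Or.inr (by simp [hzdef, hs.ne'])
  have him : ∀ t ∈ Set.Ioi (0:ℝ), t ^ (-a) / (1 + t ^ 2 + 2 * t * Real.cos θ)
      = (Real.sin θ)⁻¹ * (((t ^ (-a) : ℝ) : ℂ) / ((t:ℂ) + z)).im := by
    intro t ht
    have hns : Complex.normSq ((t:ℂ) + z) = 1 + t ^ 2 + 2 * t * Real.cos θ := by
      rw [Complex.normSq_apply]
      simp [hzdef]
      linarith
    rw [Complex.div_im, hns]
    simp [hzdef]
    field_simp
  have hi := aux_integrable ha ha1 hz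
  have hii : IntegrableOn (fun t : ℝ => (((t ^ (-a) : ℝ) : ℂ) / ((t:ℂ) + z)).im) (Set.Ioi 0) :=
    hi.im
  constructor
  · exact (integrableOn_congr_fun him measurableSet_Ioi).2 (hii.const_mul _)
  · rw [setIntegral_congr_fun measurableSet_Ioi him, integral_const_mul]
    have h1 := integral_im hi
    simp only [RCLike.im_to_complex] at h1
    rw [h1, aux_stieltjes ha ha1 hz]
    have hze : z = Complex.exp (((-θ : ℝ) : ℂ) * Complex.I) := by
      apply Complex.ext
      · rw [Complex.exp_ofReal_mul_I_re, Real.cos_neg]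
      · rw [Complex.exp_ofReal_mul_I_im, Real.sin_neg]
    have hlog : Complex.log z = ((-θ : ℝ) : ℂ) * Complex.I := by
      rw [hze, Complex.log_exp] <;> simp <;> linarith
    rw [Complex.cpow_def_of_ne_zero (Complex.slitPlane_ne_zero hz), hlog,
      show ((-θ : ℝ) : ℂ) * Complex.I * (-a : ℂ) = ((a * θ : ℝ) : ℂ) * Complex.I by
        push_cast; ring, Complex.im_ofReal_mul, Complex.exp_ofReal_mul_I_im]
    ring

lemma aux_scale {b : ℝ} (hb : 0 < b) (g : ℝ → ENNReal) :
    ∫⁻ t in Set.Ioi (0:ℝ), g t = ENNReal.ofReal b * ∫⁻ t in Set.Ioi (0:ℝ), g (b * t) := by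
  have h := lintegral_image_eq_lintegral_abs_deriv_mul (s := Set.Ioi (0:ℝ))
    (f := fun t => b * t) (f' := fun _ => b) measurableSet_Ioi
    (fun t _ => by simpa using ((hasDerivAt_id t).const_mul b).hasDerivWithinAt)
    (fun x _ y _ hxy => mul_left_cancel₀ hb.ne' hxy) g
  have him : (fun t => b * t) '' Set.Ioi (0:ℝ) = Set.Ioi 0 := by
    ext y
    simp only [Set.mem_image, Set.mem_Ioi]
    constructor
    · rintro ⟨t, ht, rfl⟩; positivity
    · intro hy; exact ⟨y / b, by positivity, by field_simp⟩
  rw [him] at h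
  rw [h, lintegral_const_mul' _ _ ENNReal.ofReal_ne_top, abs_of_pos hb]

lemma aux_denom {c x y : ℝ} (hc : -1 < c) (hx : 0 < x) (hy : 0 < y) :
    0 < x ^ 2 + y ^ 2 + 2 * x * y * c := by
  nlinarith [sq_nonneg (x - y), mul_pos (mul_pos hx hy) (by linarith : 0 < 1 + c)]

lemma aux_schur {c q : ℝ} (hc : -1 < c) (hq : 1 < q) {K : ENNReal}
    (hK : ∫⁻ t in Set.Ioi (0:ℝ), ENNReal.ofReal (t ^ (-(1 / q)) / (1 + t ^ 2 + 2 * t * c)) = K)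
    {U : ℝ → ENNReal} (hU : Measurable U) :
    ∫⁻ x in Set.Ioi (0:ℝ), (∫⁻ y in Set.Ioi (0:ℝ),
      U y * ENNReal.ofReal (x / (x ^ 2 + y ^ 2 + 2 * x * y * c))) ^ q
      ≤ K ^ q * ∫⁻ y in Set.Ioi (0:ℝ), U y ^ q := by
  have hq0 : 0 < q := by linarith
  set w : ℝ → ENNReal := fun t => ENNReal.ofReal (t ^ (-(1 / q)) / (1 + t ^ 2 + 2 * t * c))
    with hw
  have hwm : Measurable w := by rw [hw]; fun_prop
  have hd : ∀ t : ℝ, 0 < t → 0 < 1 + t ^ 2 + 2 * t * c := fun t ht => by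
    simpa using aux_denom hc one_pos ht
  have h1 : ∀ x ∈ Set.Ioi (0:ℝ), (∫⁻ y in Set.Ioi (0:ℝ),
      U y * ENNReal.ofReal (x / (x ^ 2 + y ^ 2 + 2 * x * y * c))) ^ q
      ≤ K ^ (q - 1) * ∫⁻ t in Set.Ioi (0:ℝ), U (x * t) ^ q * ENNReal.ofReal t * w t := by
    intro x hx
    have hx : 0 < x := hx
    rw [aux_scale hx, ← lintegral_const_mul' _ _ ENNReal.ofReal_ne_top]
    have e : ∀ t ∈ Set.Ioi (0:ℝ), ENNReal.ofReal x * (U (x * t) *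
        ENNReal.ofReal (x / (x ^ 2 + (x * t) ^ 2 + 2 * x * (x * t) * c)))
        = w t ^ (1 - 1 / q) * (U (x * t) ^ q * ENNReal.ofReal t * w t) ^ (1 / q) := by
      intro t ht
      have ht : 0 < t := ht
      have hdt := hd t ht
      have hpos : 0 < t ^ (-(1 / q)) / (1 + t ^ 2 + 2 * t * c) := by positivity
      have hw0 : w t ≠ 0 := by simpa [hw] using hpos
      have hwt : w t ≠ ⊤ := ENNReal.ofReal_ne_top
      have hww : w t ^ (1 - 1 / q) * w t ^ (1 / q) = w t := by
        rw [← ENNReal.rpow_add _ _ hw0 hwt, sub_add_cancel, ENNReal.rpow_one]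
      have hk : ENNReal.ofReal x *
          ENNReal.ofReal (x / (x ^ 2 + (x * t) ^ 2 + 2 * x * (x * t) * c))
          = ENNReal.ofReal t ^ (1 / q) * w t := by
        rw [ENNReal.ofReal_rpow_of_pos ht, ← ENNReal.ofReal_mul hx.le,
          ← ENNReal.ofReal_mul (by positivity), ← mul_div_assoc (t ^ (1 / q)),
          ← rpow_add ht, add_neg_cancel, rpow_zero]
        congr 1
        rw [show x ^ 2 + (x * t) ^ 2 + 2 * x * (x * t) * c = x ^ 2 * (1 + t ^ 2 + 2 * t * c) by ring]
        field_simp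
      rw [ENNReal.mul_rpow_of_nonneg _ _ (by positivity),
        ENNReal.mul_rpow_of_nonneg _ _ (by positivity), ← ENNReal.rpow_mul,
        mul_one_div_cancel hq0.ne', ENNReal.rpow_one]
      calc _ = U (x * t) * (ENNReal.ofReal x *
          ENNReal.ofReal (x / (x ^ 2 + (x * t) ^ 2 + 2 * x * (x * t) * c))) := by ring
        _ = U (x * t) * ENNReal.ofReal t ^ (1 / q) * (w t ^ (1 - 1 / q) * w t ^ (1 / q)) := by
          rw [hk, hww]; ring
        _ = _ := by ring
    rw [setLIntegral_congr_fun measurableSet_Ioi e]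
    have hq1 : 1 / q ≤ 1 := by rw [div_le_one hq0]; exact hq.le
    have hh := ENNReal.lintegral_mul_norm_pow_le (μ := volume.restrict (Set.Ioi (0:ℝ)))
      (f := w) (g := fun t => U (x * t) ^ q * ENNReal.ofReal t * w t)
      hwm.aemeasurable (by fun_prop) (p := 1 - 1 / q) (q := 1 / q) (by linarith)
      (by positivity) (by ring)
    rw [hK] at hh
    calc _ ≤ _ := ENNReal.rpow_le_rpow hh hq0.le
      _ = _ := by
        rw [ENNReal.mul_rpow_of_nonneg _ _ hq0.le, ← ENNReal.rpow_mul, ← ENNReal.rpow_mul,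
          one_div_mul_cancel hq0.ne', ENNReal.rpow_one]
        congr 2
        field_simp
  calc _ ≤ ∫⁻ x in Set.Ioi (0:ℝ), K ^ (q - 1) *
        ∫⁻ t in Set.Ioi (0:ℝ), U (x * t) ^ q * ENNReal.ofReal t * w t :=
        setLIntegral_mono' measurableSet_Ioi h1
    _ = K ^ (q - 1) * ∫⁻ x in Set.Ioi (0:ℝ),
        ∫⁻ t in Set.Ioi (0:ℝ), U (x * t) ^ q * ENNReal.ofReal t * w t := by
        rw [lintegral_const_mul]
        apply Measurable.lintegral_prod_right'
          (f := fun p : ℝ × ℝ => U (p.1 * p.2) ^ q * ENNReal.ofReal p.2 * w p.2)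
        fun_prop
    _ = K ^ (q - 1) * ∫⁻ t in Set.Ioi (0:ℝ), w t * ∫⁻ y in Set.Ioi (0:ℝ), U y ^ q := by
        rw [lintegral_lintegral_swap]
        · congr 1
          refine setLIntegral_congr_fun measurableSet_Ioi fun t ht => ?_
          have ht : 0 < t := ht
          rw [aux_scale ht (fun y => U y ^ q), ← mul_assoc, ← lintegral_const_mul]
          · refine lintegral_congr fun x => ?_
            rw [mul_comm x t]; ring
          · fun_prop
        · apply Measurable.aemeasurable
          unfold Function.uncurry
          fun_prop
    _ = K ^ (q - 1) * K * ∫⁻ y in Set.Ioi (0:ℝ), U y ^ q := by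
        rw [lintegral_mul_const _ hwm, hK, mul_assoc]
    _ = _ := by
        congr 1
        conv_lhs => rw [← ENNReal.rpow_one K, ← ENNReal.rpow_mul, one_mul]
        rw [← ENNReal.rpow_add_of_nonneg _ _ (by linarith) zero_le_one]
        congr 1; ring

lemma aux_main (v q : ℝ) (hv0 : 0 < v) (hv1 : v < 1) (hq : 1 < q)
    (u : ℝ → ℝ) (hum : Measurable u)
    (hu : MemLp u (ENNReal.ofReal q) (volume.restrict (Set.Ioi (0 : ℝ)))) :
    (∀ᵐ x ∂(volume.restrict (Set.Ioi (0 : ℝ))),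
      IntegrableOn
        (fun y : ℝ => x * u y / (x ^ 2 + y ^ 2 + 2 * x * y * Real.cos (v * Real.pi)))
        (Set.Ioi 0)) ∧
    MemLp
      (fun x : ℝ => Real.sin (v * Real.pi) / Real.pi *
        ∫ y in Set.Ioi (0 : ℝ),
          x * u y / (x ^ 2 + y ^ 2 + 2 * x * y * Real.cos (v * Real.pi)))
      (ENNReal.ofReal q) (volume.restrict (Set.Ioi (0 : ℝ))) ∧
    eLpNorm
      (fun x : ℝ => Real.sin (v * Real.pi) / Real.pi *
        ∫ y in Set.Ioi (0 : ℝ),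
          x * u y / (x ^ 2 + y ^ 2 + 2 * x * y * Real.cos (v * Real.pi)))
      (ENNReal.ofReal q) (volume.restrict (Set.Ioi (0 : ℝ))) ≤
      ENNReal.ofReal (Real.sin (v * Real.pi / q) / Real.sin (Real.pi / q)) *
        eLpNorm u (ENNReal.ofReal q) (volume.restrict (Set.Ioi (0 : ℝ))) := by
  have hq0 : 0 < q := by linarith
  have hθ : 0 < v * π := by positivity
  have hθ1 : v * π < π := by nlinarith [pi_pos]
  have hsin : 0 < Real.sin (v * π) := Real.sin_pos_of_pos_of_lt_pi hθ hθ1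
  set c := Real.cos (v * π) with hcdef
  have hc : -1 < c := by
    have h1 := Real.cos_sq_add_sin_sq (v * π)
    rw [← hcdef] at h1
    nlinarith [Real.neg_one_le_cos (v * π)]
  have ha : 0 < 1 / q := by positivity
  have ha1 : 1 / q < 1 := by rw [div_lt_one hq0]; exact hq
  obtain ⟨hki, hkv⟩ := aux_kernel ha ha1 hθ hθ1
  rw [← hcdef] at hki hkv
  set Kr : ℝ := π / Real.sin (π * (1 / q)) * (Real.sin (1 / q * (v * π)) / Real.sin (v * π))
    with hKr
  have hK : ∫⁻ t in Set.Ioi (0:ℝ), ENNReal.ofReal (t ^ (-(1 / q)) / (1 + t ^ 2 + 2 * t * c))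
      = ENNReal.ofReal Kr := by
    rw [← hkv, ofReal_integral_eq_lintegral_ofReal hki]
    filter_upwards [ae_restrict_mem measurableSet_Ioi] with t ht
    have ht : 0 < t := ht
    have : 0 < 1 + t ^ 2 + 2 * t * c := by simpa using aux_denom hc one_pos ht
    simp only [Pi.zero_apply]; positivity
  have hUm : Measurable (fun y => ‖u y‖ₑ) := by fun_prop
  have hmain := aux_schur hc hq hK hUm
  set T : ℝ → ENNReal := fun x => ∫⁻ y in Set.Ioi (0:ℝ),
      ‖u y‖ₑ * ENNReal.ofReal (x / (x ^ 2 + y ^ 2 + 2 * x * y * c)) with hT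
  have hTm : Measurable T := by
    apply Measurable.lintegral_prod_right' (f := fun p : ℝ × ℝ => ‖u p.2‖ₑ *
      ENNReal.ofReal (p.1 / (p.1 ^ 2 + p.2 ^ 2 + 2 * p.1 * p.2 * c)))
    fun_prop
  have hp0 : ENNReal.ofReal q ≠ 0 := by simpa using hq0
  have hpt : ENNReal.ofReal q ≠ ⊤ := ENNReal.ofReal_ne_top
  have hptr : (ENNReal.ofReal q).toReal = q := ENNReal.toReal_ofReal hq0.le
  have hfin : ∫⁻ y in Set.Ioi (0:ℝ), ‖u y‖ₑ ^ q < ⊤ := by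
    have := lintegral_rpow_enorm_lt_top_of_eLpNorm_lt_top hp0 hpt hu.2
    rwa [hptr] at this
  have hTfin : ∫⁻ x in Set.Ioi (0:ℝ), T x ^ q < ⊤ :=
    hmain.trans_lt (ENNReal.mul_lt_top
      (ENNReal.rpow_lt_top_of_nonneg hq0.le ENNReal.ofReal_ne_top) hfin)
  have hnorm : ∀ x : ℝ, 0 < x → ∫⁻ y in Set.Ioi (0:ℝ),
      ‖x * u y / (x ^ 2 + y ^ 2 + 2 * x * y * c)‖ₑ = T x := by
    intro x hx
    refine setLIntegral_congr_fun measurableSet_Ioi fun y hy => ?_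
    have hy : 0 < y := hy
    have hd := aux_denom hc hx hy
    rw [mul_comm x (u y), mul_div_assoc, enorm_mul, Real.enorm_of_nonneg
      (r := x / (x ^ 2 + y ^ 2 + 2 * x * y * c)) (by positivity)]
  have hA : ∀ᵐ x ∂(volume.restrict (Set.Ioi (0 : ℝ))), IntegrableOn
        (fun y : ℝ => x * u y / (x ^ 2 + y ^ 2 + 2 * x * y * c)) (Set.Ioi 0) := by
    have h1 := ae_lt_top (hTm.pow_const q) hTfin.ne
    filter_upwards [h1, ae_restrict_mem measurableSet_Ioi] with x hx hx0
    refine ⟨Measurable.aestronglyMeasurable (by fun_prop), ?_⟩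
    rw [hasFiniteIntegral_iff_enorm, hnorm x hx0]
    exact (ENNReal.rpow_lt_top_iff_of_pos hq0).1 hx
  have hFm : AEStronglyMeasurable (fun x : ℝ => Real.sin (v * Real.pi) / Real.pi *
        ∫ y in Set.Ioi (0 : ℝ), x * u y / (x ^ 2 + y ^ 2 + 2 * x * y * c))
        (volume.restrict (Set.Ioi (0 : ℝ))) := by
    apply StronglyMeasurable.aestronglyMeasurable
    apply StronglyMeasurable.const_mul
    apply StronglyMeasurable.integral_prod_right' (f := fun p : ℝ × ℝ => p.1 * u p.2 /
      (p.1 ^ 2 + p.2 ^ 2 + 2 * p.1 * p.2 * c))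
    apply Measurable.stronglyMeasurable
    fun_prop
  have hB : eLpNorm
      (fun x : ℝ => Real.sin (v * Real.pi) / Real.pi *
        ∫ y in Set.Ioi (0 : ℝ),
          x * u y / (x ^ 2 + y ^ 2 + 2 * x * y * c))
      (ENNReal.ofReal q) (volume.restrict (Set.Ioi (0 : ℝ))) ≤
      ENNReal.ofReal (Real.sin (v * Real.pi / q) / Real.sin (Real.pi / q)) *
        eLpNorm u (ENNReal.ofReal q) (volume.restrict (Set.Ioi (0 : ℝ))) := by
    have hS : 0 ≤ Real.sin (v * π) / π := by positivity
    have hconst : Real.sin (v * Real.pi / q) / Real.sin (Real.pi / q)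
        = Real.sin (v * π) / π * Kr := by
      rw [hKr, show π * (1 / q) = π / q by ring, show 1 / q * (v * π) = v * π / q by ring]
      field_simp
    rw [eLpNorm_eq_lintegral_rpow_enorm_toReal hp0 hpt,
      eLpNorm_eq_lintegral_rpow_enorm_toReal hp0 hpt, hptr, hconst, ENNReal.ofReal_mul hS]
    have hle : ∫⁻ x in Set.Ioi (0:ℝ), ‖Real.sin (v * Real.pi) / Real.pi *
        ∫ y in Set.Ioi (0 : ℝ), x * u y / (x ^ 2 + y ^ 2 + 2 * x * y * c)‖ₑ ^ q
        ≤ (ENNReal.ofReal (Real.sin (v * π) / π) * ENNReal.ofReal Kr) ^ q *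
          ∫⁻ y in Set.Ioi (0:ℝ), ‖u y‖ₑ ^ q := by
      calc _ ≤ ∫⁻ x in Set.Ioi (0:ℝ), ENNReal.ofReal (Real.sin (v * π) / π) ^ q * T x ^ q := by
            refine setLIntegral_mono' measurableSet_Ioi fun x hx => ?_
            rw [← ENNReal.mul_rpow_of_nonneg _ _ hq0.le]
            refine ENNReal.rpow_le_rpow ?_ hq0.le
            rw [enorm_mul, Real.enorm_of_nonneg hS]
            gcongr
            exact (enorm_integral_le_lintegral_enorm _).trans (hnorm x hx).le
        _ = ENNReal.ofReal (Real.sin (v * π) / π) ^ q * ∫⁻ x in Set.Ioi (0:ℝ), T x ^ q :=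
            lintegral_const_mul _ (hTm.pow_const q)
        _ ≤ ENNReal.ofReal (Real.sin (v * π) / π) ^ q * (ENNReal.ofReal Kr ^ q *
            ∫⁻ y in Set.Ioi (0:ℝ), ‖u y‖ₑ ^ q) := by gcongr
        _ = _ := by rw [ENNReal.mul_rpow_of_nonneg _ _ hq0.le, mul_assoc]
    calc _ ≤ _ := ENNReal.rpow_le_rpow hle (by positivity : 0 ≤ 1 / q)
      _ = _ := by
        rw [ENNReal.mul_rpow_of_nonneg _ _ (by positivity), ← ENNReal.rpow_mul,
          mul_one_div_cancel hq0.ne', ENNReal.rpow_one]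
  exact ⟨hA, ⟨hFm, hB.trans_lt (ENNReal.mul_lt_top ENNReal.ofReal_lt_top hu.2)⟩, hB⟩


/-- Fix `v ∈ (0,1)` and `1 < q < ∞`. For `u ∈ L^q(0,∞)`, the operator
`(Ru)(x) = (sin(vπ)/π) ∫₀^∞ x·u(y)/(x² + y² + 2xy·cos(vπ)) dy` is defined by an
absolutely convergent integral for a.e. `x > 0`, maps into `L^q(0,∞)`, and
`‖Ru‖_{L^q} ≤ (sin(vπ/q)/sin(π/q))·‖u‖_{L^q}`. -/
theorem corner_operator_Lq_bound (v q : ℝ) (hv0 : 0 < v) (hv1 : v < 1) (hq : 1 < q)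
    (u : ℝ → ℝ)
    (hu : MemLp u (ENNReal.ofReal q) (volume.restrict (Set.Ioi (0 : ℝ)))) :
    (∀ᵐ x ∂(volume.restrict (Set.Ioi (0 : ℝ))),
      IntegrableOn
        (fun y : ℝ => x * u y / (x ^ 2 + y ^ 2 + 2 * x * y * Real.cos (v * Real.pi)))
        (Set.Ioi 0)) ∧
    MemLp
      (fun x : ℝ => Real.sin (v * Real.pi) / Real.pi *
        ∫ y in Set.Ioi (0 : ℝ),
          x * u y / (x ^ 2 + y ^ 2 + 2 * x * y * Real.cos (v * Real.pi)))
      (ENNReal.ofReal q) (volume.restrict (Set.Ioi (0 : ℝ))) ∧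
    eLpNorm
      (fun x : ℝ => Real.sin (v * Real.pi) / Real.pi *
        ∫ y in Set.Ioi (0 : ℝ),
          x * u y / (x ^ 2 + y ^ 2 + 2 * x * y * Real.cos (v * Real.pi)))
      (ENNReal.ofReal q) (volume.restrict (Set.Ioi (0 : ℝ))) ≤
      ENNReal.ofReal (Real.sin (v * Real.pi / q) / Real.sin (Real.pi / q)) *
        eLpNorm u (ENNReal.ofReal q) (volume.restrict (Set.Ioi (0 : ℝ))) := by
  have hae := hu.1.ae_eq_mk
  set u' := hu.1.mk u with hu'
  have hm : Measurable u' := hu.1.stronglyMeasurable_mk.measurable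
  have hmem : MemLp u' (ENNReal.ofReal q) (volume.restrict (Set.Ioi (0 : ℝ))) :=
    (memLp_congr_ae hae).1 hu
  have hcong : ∀ x : ℝ,
      (fun y : ℝ => x * u y / (x ^ 2 + y ^ 2 + 2 * x * y * Real.cos (v * Real.pi)))
      =ᵐ[volume.restrict (Set.Ioi (0 : ℝ))]
      (fun y : ℝ => x * u' y / (x ^ 2 + y ^ 2 + 2 * x * y * Real.cos (v * Real.pi))) := by
    intro x
    filter_upwards [hae] with y hy
    rw [hy]
  have hint : (fun x : ℝ => Real.sin (v * Real.pi) / Real.pi *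
        ∫ y in Set.Ioi (0 : ℝ),
          x * u y / (x ^ 2 + y ^ 2 + 2 * x * y * Real.cos (v * Real.pi)))
      = (fun x : ℝ => Real.sin (v * Real.pi) / Real.pi *
        ∫ y in Set.Ioi (0 : ℝ),
          x * u' y / (x ^ 2 + y ^ 2 + 2 * x * y * Real.cos (v * Real.pi))) := by
    funext x
    rw [integral_congr_ae (hcong x)]
  obtain ⟨h1, h2, h3⟩ := aux_main v q hv0 hv1 hq u' hm hmem
  rw [hint, eLpNorm_congr_ae hae]
  refine ⟨?_, h2, h3⟩
  filter_upwards [h1] with x hx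
  exact Integrable.congr hx (hcong x).symm
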